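/- Let G be a Ferrers graph with vertex set partitioned as R ⊔ C where |R| = m and |C| = n. Then m · n · τ(G) = ∏_{i=1}^{m} deg(r_i) · ∏_{j=1}^{n} deg(c_j), where deg denotes the degree of a vertex in G. -/

import Mathlib

open scoped BigOperators

/-- The number of spanning trees of a finite simple graph `G`. -/
noncomputable def tau {V : Type} [Fintype V] (G : SimpleGraph V) : ℕ :=
  Nat.card {H : SimpleGraph V // H ≤ G ∧ H.IsTree}

/-- The degree of a vertex. -/
noncomputable def deg {V : Type} (G : SimpleGraph V) (x : V) : ℕ :=
  (G.neighborSet x).ncard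


/-- A matrix which is triangular with respect to some integer ranking of its index type has
determinant equal to the product of its diagonal entries. -/
theorem det_eq_prod_diag_of_rank {V : Type*} [Fintype V] [DecidableEq V] (M : Matrix V V ℤ)
    (ρ : V → ℤ) (h : ∀ a b, a ≠ b → ρ a ≤ ρ b → M a b = 0) : M.det = ∏ v, M v v := by
  rw [Matrix.det_apply, Finset.sum_eq_single 1]
  · simp
  · intro σ _ hσ
    suffices ∃ v, M (σ v) v = 0 by
      obtain ⟨v, hv⟩ := this
      have hprod : ∏ i, M (σ i) i = 0 := Finset.prod_eq_zero (Finset.mem_univ v) hv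
      exact (congrArg _ hprod).trans (smul_zero _)
    by_contra! hne
    have hle : ∀ v, ρ v ≤ ρ (σ v) := by
      intro v
      by_contra! hlt
      exact hne v (h _ _ (by intro he; rw [he] at hlt; exact lt_irrefl _ hlt) hlt.le)
    obtain ⟨v, hv⟩ : ∃ v, σ v ≠ v := by
      by_contra! hall
      exact hσ (Equiv.ext hall)
    have hlt : ρ v < ρ (σ v) := lt_of_not_ge fun hge => hne v (h _ _ hv hge)
    have := Finset.sum_lt_sum (s := Finset.univ) (fun v _ => hle v) ⟨v, Finset.mem_univ v, hlt⟩
    rw [Equiv.sum_comp σ ρ] at this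
    exact lt_irrefl _ this
  · simp

/-- `f` is the parent function of a spanning tree of `G` rooted at `root`. -/
def IsParentFun {V : Type*} (G : SimpleGraph V) (root : V) (f : V → V) : Prop :=
  f root = root ∧ (∀ v, v ≠ root → G.Adj v (f v)) ∧ ∀ v, ∃ k, f^[k] v = root

/-- The graph joining every vertex to its image under `f`. -/
def parentGraph {V : Type*} (f : V → V) : SimpleGraph V :=
  SimpleGraph.fromRel fun v w => f v = w

theorem parentGraph_adj {V : Type*} {f : V → V} {v w : V} :
    (parentGraph f).Adj v w ↔ v ≠ w ∧ (f v = w ∨ f w = v) :=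
  SimpleGraph.fromRel_adj _ _ _

namespace IsParentFun

variable {V : Type*} {G : SimpleGraph V} {root : V} {f g : V → V}

theorem ne_root_of_adj (hf : IsParentFun G root f) {v w : V} (hvw : v ≠ w) (h : f v = w) :
    v ≠ root := by
  rintro rfl
  exact hvw (hf.1.symm.trans h)

theorem parentGraph_le (hf : IsParentFun G root f) : parentGraph f ≤ G := by
  intro v w h
  obtain ⟨hne, h | h⟩ := parentGraph_adj.1 h
  · exact h ▸ hf.2.1 v (hf.ne_root_of_adj hne h)
  · exact (h ▸ hf.2.1 w (hf.ne_root_of_adj hne.symm h)).symm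

theorem adj_parentGraph (hf : IsParentFun G root f) {v : V} (hv : v ≠ root) :
    (parentGraph f).Adj v (f v) :=
  parentGraph_adj.2 ⟨(hf.2.1 v hv).ne, Or.inl rfl⟩

theorem parentGraph_connected (hf : IsParentFun G root f) : (parentGraph f).Connected := by
  have key : ∀ k v, f^[k] v = root → (parentGraph f).Reachable v root := by
    intro k
    induction k with
    | zero => rintro v rfl; rfl
    | succ k ih =>
      intro v hv
      by_cases hr : v = root
      · rw [hr]
      · exact (hf.adj_parentGraph hr).reachable.trans (ih _ hv)
  have : Nonempty V := ⟨root⟩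
  refine ⟨fun v w => ?_⟩
  obtain ⟨k, hk⟩ := hf.2.2 v
  obtain ⟨l, hl⟩ := hf.2.2 w
  exact (key k v hk).trans (key l w hl).symm

theorem parentGraph_isTree [Finite V] (hf : IsParentFun G root f) : (parentGraph f).IsTree := by
  rw [SimpleGraph.isTree_iff_connected_and_card]
  refine ⟨hf.parentGraph_connected,
    le_antisymm ?_ hf.parentGraph_connected.card_vert_le_card_edgeSet_add_one⟩
  have hsub : (parentGraph f).edgeSet ⊆ (fun v => s(v, f v)) '' {root}ᶜ := by
    intro e
    induction e with
    | _ v w =>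
      intro h
      obtain ⟨hne, h | h⟩ := parentGraph_adj.1 h
      · exact ⟨v, hf.ne_root_of_adj hne h, by simp [h]⟩
      · exact ⟨w, hf.ne_root_of_adj hne.symm h, by simp [h, Sym2.eq_swap]⟩
  have h1 := (Set.ncard_le_ncard hsub (Set.toFinite _)).trans (Set.ncard_image_le (Set.toFinite _))
  have h2 := Set.ncard_add_ncard_compl ({root} : Set V)
  rw [Set.ncard_singleton] at h2
  rw [Nat.card_coe_set_eq]
  omega

theorem ext_of_parentGraph_eq (hf : IsParentFun G root f) (hg : IsParentFun G root g)
    (h : parentGraph f = parentGraph g) : f = g := by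
  have key : ∀ k v, g^[k] v = root → f v = g v := by
    intro k
    induction k with
    | zero => rintro v rfl; exact hf.1.trans hg.1.symm
    | succ k ih =>
      intro v hv
      by_cases hr : v = root
      · rw [hr, hf.1, hg.1]
      have hadj := hg.adj_parentGraph hr
      rw [← h] at hadj
      obtain ⟨hne, h1 | h1⟩ := parentGraph_adj.1 hadj
      · exact h1
      exfalso
      have h2 : g (g v) = v := (ih _ hv).symm.trans h1
      have h3 : ∀ j, g^[j] v = v ∨ g^[j] v = g v := by
        intro j
        induction j with
        | zero => exact Or.inl rfl
        | succ j ihj =>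
          rw [Function.iterate_succ_apply']
          rcases ihj with e | e <;> rw [e]
          · exact Or.inr rfl
          · exact Or.inl h2
      rcases h3 (k + 1) with e | e
      · exact hr (e.symm.trans hv)
      · rw [e.symm.trans hv, hg.1] at h2
        exact hr h2.symm
  funext v
  obtain ⟨k, hk⟩ := hg.2.2 v
  exact key k v hk

end IsParentFun

theorem exists_isParentFun_of_connected {V : Type*} {G : SimpleGraph V} (hG : G.Connected)
    (root : V) : ∃ f, IsParentFun G root f := by
  have step : ∀ v, ∃ w, (v = root → w = root) ∧
      (v ≠ root → G.Adj v w ∧ G.dist w root < G.dist v root) := by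
    intro v
    by_cases hv : v = root
    · exact ⟨root, fun _ => rfl, fun h => (h hv).elim⟩
    obtain ⟨p, hp⟩ := hG.exists_walk_length_eq_dist v root
    cases p with
    | nil => exact (hv rfl).elim
    | cons h q =>
      refine ⟨_, fun e => (hv e).elim, fun _ => ⟨h, ?_⟩⟩
      rw [← hp, SimpleGraph.Walk.length_cons]
      exact Nat.lt_succ_of_le (SimpleGraph.dist_le q)
  choose f hf using step
  refine ⟨f, (hf root).1 rfl, fun v hv => ((hf v).2 hv).1, ?_⟩
  suffices ∀ d v, G.dist v root ≤ d → ∃ k, f^[k] v = root from fun v => this _ v le_rfl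
  intro d
  induction d with
  | zero => exact fun v hv => ⟨0, hG.dist_eq_zero_iff.1 (Nat.le_zero.1 hv)⟩
  | succ d ih =>
    intro v hv
    by_cases hr : v = root
    · exact ⟨0, hr⟩
    obtain ⟨k, hk⟩ := ih (f v) (Nat.le_of_lt_succ (((hf v).2 hr).2.trans_le hv))
    exact ⟨k + 1, hk⟩

theorem tau_eq_card_isParentFun {V : Type} [Fintype V] (G : SimpleGraph V) (root : V) :
    tau G = Nat.card {f // IsParentFun G root f} := by
  symm
  refine Nat.card_congr (Equiv.ofBijective
    (fun f => ⟨parentGraph f.1, f.2.parentGraph_le, f.2.parentGraph_isTree⟩) ⟨?_, ?_⟩)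
  · intro f g h
    exact Subtype.ext (f.2.ext_of_parentGraph_eq g.2 (congrArg Subtype.val h))
  · rintro ⟨T, hle, hT⟩
    obtain ⟨f, hf⟩ := exists_isParentFun_of_connected hT.connected root
    refine ⟨⟨f, hf.1, fun v hv => hle (hf.2.1 v hv), hf.2.2⟩, Subtype.ext ?_⟩
    exact le_antisymm hf.parentGraph_le
      ((SimpleGraph.isTree_iff_minimal_connected.1 hT).2 hf.parentGraph_connected
        hf.parentGraph_le)

open Classical in
/-- The matrix `1 - P` for the partial function `f` undefined at `root`, with the rows `v` at
which `v` and `f v` are not adjacent (or `f root ≠ root`) replaced by zero. -/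
noncomputable def parentMatrix {V : Type*} (G : SimpleGraph V) (root : V) (f : V → V) :
    Matrix V V ℤ := fun v =>
  if v = root then (if f v = root then Pi.single root 1 else 0)
  else if G.Adj v (f v) then Pi.single v 1 - Pi.single (f v) 1 else 0

open Classical in
theorem det_parentMatrix {V : Type*} [Fintype V] (G : SimpleGraph V) (root : V) (f : V → V) :
    (parentMatrix G root f).det = if IsParentFun G root f then 1 else 0 := by
  split_ifs with hf
  · obtain ⟨h0, h1, h2⟩ := hf
    have hlt : ∀ v, v ≠ root → Nat.find (h2 (f v)) < Nat.find (h2 v) := by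
      intro v hv
      have hspec := Nat.find_spec (h2 v)
      cases hk : Nat.find (h2 v) with
      | zero => rw [hk] at hspec; exact (hv hspec).elim
      | succ k =>
        rw [hk] at hspec
        exact Nat.lt_succ_of_le (Nat.find_min' _ hspec)
    rw [det_eq_prod_diag_of_rank _ fun v => (Nat.find (h2 v) : ℤ)]
    · refine Finset.prod_eq_one fun v _ => ?_
      by_cases hv : v = root
      · simp [parentMatrix, hv, h0]
      · simp [parentMatrix, hv, h1 v hv, (h1 v hv).ne]
    · intro v w hvw hle
      by_cases hv : v = root
      · subst hv
        simp [parentMatrix, h0, hvw.symm]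
      · have : w ≠ f v := by
          rintro rfl
          exact absurd (hlt v hv) (by exact_mod_cast not_lt.2 hle)
        simp [parentMatrix, hv, h1 v hv, hvw.symm, this]
  · by_cases h0 : f root = root
    swap
    · exact Matrix.det_eq_zero_of_row_eq_zero root fun j => by simp [parentMatrix, h0]
    by_cases h1 : ∀ v, v ≠ root → G.Adj v (f v)
    swap
    · push Not at h1
      obtain ⟨v, hv, hadj⟩ := h1
      exact Matrix.det_eq_zero_of_row_eq_zero v fun j => by simp [parentMatrix, hv, hadj]
    have h2 : ∃ v, ∀ k, f^[k] v ≠ root := by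
      by_contra! h2
      exact hf ⟨h0, h1, h2⟩
    let x : V → ℤ := fun v => if ∃ k, f^[k] v = root then 0 else 1
    have hxf : ∀ v, x (f v) = x v := by
      intro v
      have : (∃ k, f^[k] (f v) = root) ↔ ∃ k, f^[k] v = root := by
        constructor
        · rintro ⟨k, hk⟩
          exact ⟨k + 1, hk⟩
        · rintro ⟨k, hk⟩
          refine ⟨k, ?_⟩
          rw [← Function.iterate_succ_apply, Function.iterate_succ_apply', hk, h0]
      simp only [x, this]
    refine Matrix.exists_mulVec_eq_zero_iff.1 ⟨x, ?_, ?_⟩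
    · obtain ⟨v, hv⟩ := h2
      intro hx
      have := congrFun hx v
      simp [x, hv] at this
    · funext v
      have hxr : x root = 0 := if_pos ⟨0, rfl⟩
      by_cases hv : v = root
      · subst hv
        simp [parentMatrix, Matrix.mulVec, h0, hxr]
      · simp only [parentMatrix, Matrix.mulVec, hv, h1 v hv, if_false, if_true]
        change (Pi.single v 1 - Pi.single (f v) 1 : V → ℤ) ⬝ᵥ x = 0
        simp [sub_dotProduct, hxf]

open Classical in
/-- The matrix-tree theorem. -/
theorem det_updateRow_lapMatrix_eq_tau {V : Type} [Fintype V] (G : SimpleGraph V) (root : V) :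
    ((G.lapMatrix ℤ).updateRow root (Pi.single root 1)).det = tau G := by
  let g : V → V → V → ℤ := fun v u =>
    if v = root then (if u = root then Pi.single root 1 else 0)
    else if G.Adj v u then Pi.single v 1 - Pi.single u 1 else 0
  have hK : (G.lapMatrix ℤ).updateRow root (Pi.single root 1) = fun v => ∑ u, g v u := by
    funext v w
    by_cases hv : v = root
    · subst hv
      simp only [g, if_true, Finset.sum_ite_eq', Finset.mem_univ, Matrix.updateRow_self]
    · rw [Matrix.updateRow_ne hv, Finset.sum_apply]
      simp only [g, hv, if_false]
      have : ∀ u, (if G.Adj v u then Pi.single v 1 - Pi.single u 1 else (0 : V → ℤ)) w =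
          (if G.Adj v u then 1 else 0) * (Pi.single v 1 : V → ℤ) w -
            (if w = u then (if G.Adj v u then 1 else 0) else 0) := by
        intro u
        split_ifs <;> simp_all
      simp_rw [this]
      rw [Finset.sum_sub_distrib, ← Finset.sum_mul, ← G.degree_eq_sum_if_adj]
      by_cases hw : v = w
      · subst hw; simp [SimpleGraph.lapMatrix, SimpleGraph.degMatrix]
      · simp [SimpleGraph.lapMatrix, SimpleGraph.degMatrix, hw, Ne.symm hw,
          SimpleGraph.adjMatrix_apply]
  have hsum := (Matrix.detRowAlternating (n := V) (R := ℤ)).toMultilinearMap.map_sum g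
  rw [hK]
  refine hsum.trans ((Finset.sum_congr rfl fun f _ => det_parentMatrix G root f).trans ?_)
  rw [Finset.sum_boole, tau_eq_card_isParentFun G root, Nat.card_eq_fintype_card,
    Fintype.card_subtype]

/-- A rank one perturbation of a matrix with vanishing row and column sums. -/
theorem det_add_vecMulVec_of_sums_eq_zero {V : Type*} [Fintype V] [DecidableEq V]
    (L : Matrix V V ℤ) (hrow : ∀ v, ∑ w, L v w = 0) (hcol : ∀ w, ∑ v, L v w = 0)
    (x y : V → ℤ) (root : V) :
    (L + Matrix.vecMulVec x y).det =
      (∑ v, x v) * (∑ v, y v) * (L.updateRow root (Pi.single root 1)).det := by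
  have h1 := Matrix.det_updateRow_sum (L + Matrix.vecMulVec x y) root fun _ => 1
  have h2 : ∑ k, (1 : ℤ) • (L + Matrix.vecMulVec x y) k = (∑ v, x v) • y := by
    funext w
    refine (Finset.sum_apply w _ _).trans ?_
    simp [Matrix.vecMulVec_apply, Finset.sum_add_distrib, hcol, Finset.sum_mul]
  rw [h2, Matrix.det_updateRow_smul, one_smul] at h1
  have h3 : ((L + Matrix.vecMulVec x y).updateRow root y).det = (L.updateRow root y).det := by
    refine Matrix.det_eq_of_forall_row_eq_smul_add_const
      (fun v => if v = root then 0 else x v) root (by simp) fun v w => ?_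
    by_cases hv : v = root
    · subst hv; simp
    · simp [hv, Matrix.vecMulVec_apply]
  have h4 : (L.updateRow root (y - (∑ v, y v) • Pi.single root 1)).det = 0 := by
    refine Matrix.exists_mulVec_eq_zero_iff.1 ⟨fun _ => 1, ?_, ?_⟩
    · intro h
      exact one_ne_zero (congrFun h root)
    · funext v
      by_cases hv : v = root
      · subst hv
        simp [Matrix.mulVec, dotProduct, Finset.sum_sub_distrib, ← Finset.mul_sum]
      · simp [Matrix.mulVec, dotProduct, Matrix.updateRow_ne hv, hrow]
  have h5 := Matrix.det_updateRow_add L root (y - (∑ v, y v) • Pi.single root 1)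
    ((∑ v, y v) • Pi.single root 1)
  rw [sub_add_cancel, h4, zero_add, Matrix.det_updateRow_smul] at h5
  rw [← h1, h3, h5, mul_assoc]

/-- Spanning tree count of a Ferrers graph with parts `R = {r 0, …, r (m-1)}` and
`C = {c 0, …, c (n-1)}`: `m · n · τ(G) = ∏ᵢ deg(rᵢ) · ∏ⱼ deg(cⱼ)`. -/
theorem stmt8 {V : Type} [Fintype V] (G : SimpleGraph V)
    (m n : ℕ) (hm : 0 < m) (hn : 0 < n) (r : Fin m → V) (c : Fin n → V)
    (hr : Function.Injective r) (hc : Function.Injective c)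
    (hrc : ∀ i j, r i ≠ c j)
    (hcover : ∀ x : V, (∃ i, x = r i) ∨ (∃ j, x = c j))
    (hedges : ∀ x y : V, G.Adj x y →
      ((∃ i j, x = r i ∧ y = c j) ∨ (∃ i j, x = c i ∧ y = r j)))
    (hcorner₁ : G.Adj (r ⟨0, hm⟩) (c ⟨n - 1, Nat.sub_lt hn Nat.one_pos⟩))
    (hcorner₂ : G.Adj (r ⟨m - 1, Nat.sub_lt hm Nat.one_pos⟩) (c ⟨0, hn⟩))
    (hmono : ∀ (k : Fin m) (l : Fin n), G.Adj (r k) (c l) →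
      ∀ (i : Fin m) (j : Fin n), i ≤ k → j ≤ l → G.Adj (r i) (c j)) :
    m * n * tau G = (∏ i, deg G (r i)) * ∏ j, deg G (c j) := by
  classical
  have he : Function.Bijective (Sum.elim r c) :=
    ⟨hr.sumElim hc hrc, fun x => (hcover x).elim (fun ⟨i, hi⟩ => ⟨Sum.inl i, hi.symm⟩)
      fun ⟨j, hj⟩ => ⟨Sum.inr j, hj.symm⟩⟩
  let e : Fin m ⊕ Fin n ≃ V := Equiv.ofBijective _ he
  have hel (i : Fin m) : e.symm (r i) = Sum.inl i := e.symm_apply_eq.2 rfl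
  have her (j : Fin n) : e.symm (c j) = Sum.inr j := e.symm_apply_eq.2 rfl
  have hsumV (z : V → ℤ) : ∑ v, z v = ∑ i, z (r i) + ∑ j, z (c j) := by
    rw [← Equiv.sum_comp e, Fintype.sum_sum_type]
    rfl
  have hprodV (z : V → ℤ) : ∏ v, z v = (∏ i, z (r i)) * ∏ j, z (c j) := by
    rw [← Equiv.prod_comp e, Fintype.prod_sum_type]
    rfl
  have hdeg (v : V) : deg G v = G.degree v := by
    rw [deg, Set.ncard_eq_toFinset_card', Set.toFinset_card, G.card_neighborSet_eq_degree]
  have hrr (i k : Fin m) : ¬ G.Adj (r i) (r k) := fun h => by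
    rcases hedges _ _ h with ⟨_, j, _, h⟩ | ⟨j, _, h, _⟩
    · exact hrc _ _ h
    · exact hrc _ _ h
  have hcc (j l : Fin n) : ¬ G.Adj (c j) (c l) := fun h => by
    rcases hedges _ _ h with ⟨i, _, h, _⟩ | ⟨_, i, _, h⟩
    · exact hrc _ _ h.symm
    · exact hrc _ _ h.symm
  have hlt {i : Fin m} {j : Fin n} (h : G.Adj (r i) (c j)) : (j : ℕ) < deg G (r i) := by
    have hsub : c '' Set.Iic j ⊆ G.neighborSet (r i) := by
      rintro _ ⟨l, hl, rfl⟩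
      exact hmono i j h i l le_rfl hl
    have := Set.ncard_le_ncard hsub (Set.toFinite _)
    rw [Set.ncard_image_of_injective _ hc, Set.ncard_eq_toFinset_card', Set.toFinset_Iic,
      Fin.card_Iic] at this
    exact this
  have hge {i : Fin m} {j : Fin n} (h : ¬ G.Adj (r i) (c j)) : deg G (r i) ≤ j := by
    have hsub : G.neighborSet (r i) ⊆ c '' Set.Iio j := by
      intro v hv
      rcases hcover v with ⟨k, rfl⟩ | ⟨l, rfl⟩
      · exact (hrr i k hv).elim
      · exact ⟨l, lt_of_not_ge fun hjl => h (hmono i l hv i j le_rfl hjl), rfl⟩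
    have := Set.ncard_le_ncard hsub (Set.toFinite _)
    rw [Set.ncard_image_of_injective _ hc, Set.ncard_eq_toFinset_card' (Set.Iio j), Set.toFinset_Iio,
      Fin.card_Iio] at this
    exact this
  let x : V → ℤ := fun v => Sum.elim (fun _ => 1) (fun _ => 0) (e.symm v)
  let y : V → ℤ := fun v => Sum.elim (fun _ => 0) (fun _ => 1) (e.symm v)
  let ρ : V → ℤ := fun v =>
    Sum.elim (fun i : Fin m => -2 * (deg G (r i) : ℤ)) (fun j : Fin n => -(2 * (j : ℤ) + 1))
      (e.symm v)
  have hlap (v w : V) : G.lapMatrix ℤ v w =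
      (if v = w then (G.degree v : ℤ) else 0) - if G.Adj v w then 1 else 0 := by
    simp [SimpleGraph.lapMatrix, SimpleGraph.degMatrix, Matrix.diagonal_apply,
      SimpleGraph.adjMatrix_apply]
  have hrow (v : V) : ∑ w, G.lapMatrix ℤ v w = 0 := by
    simpa [Matrix.mulVec, dotProduct] using congrFun (G.lapMatrix_mulVec_const_eq_zero (R := ℤ)) v
  have hcol (w : V) : ∑ v, G.lapMatrix ℤ v w = 0 := by
    simpa only [(G.isSymm_lapMatrix ℤ).apply] using hrow w
  have hdet := det_add_vecMulVec_of_sums_eq_zero (G.lapMatrix ℤ) hrow hcol x y (r ⟨0, hm⟩)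
  rw [det_updateRow_lapMatrix_eq_tau, det_eq_prod_diag_of_rank _ ρ, hsumV x, hsumV y,
    hprodV] at hdet
  · simp only [Matrix.add_apply, Matrix.vecMulVec_apply, hlap, x, y, hel, her, Sum.elim_inl,
      Sum.elim_inr, if_true, SimpleGraph.irrefl, if_false, mul_zero, sub_zero, add_zero,
      Finset.sum_const, Finset.card_univ, Fintype.card_fin, zero_add, smul_zero, nsmul_eq_mul,
      mul_one] at hdet
    simp only [hdeg]
    exact_mod_cast hdet.symm
  · intro a b hab hρ
    simp only [Matrix.add_apply, Matrix.vecMulVec_apply, hlap, hab, if_false]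
    rcases hcover a with ⟨i, rfl⟩ | ⟨j, rfl⟩ <;> rcases hcover b with ⟨k, rfl⟩ | ⟨l, rfl⟩
    · simp [x, y, hel, hrr]
    · have hadj : G.Adj (r i) (c l) := by
        by_contra h
        have := hge h
        simp only [ρ, hel, her, Sum.elim_inl, Sum.elim_inr] at hρ
        omega
      simp [x, y, hel, her, hadj]
    · have hadj : ¬ G.Adj (c j) (r k) := by
        intro h
        have := hlt h.symm
        simp only [ρ, hel, her, Sum.elim_inl, Sum.elim_inr] at hρ
        omega
      simp [x, y, hel, her, hadj]
    · simp [x, y, her, hcc]
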